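/- In ℤ⟦X⟧, the spherical generating functions U and V of the cubic matrix model satisfy V = 2U + X·V^2, and consequently V satisfies the cubic algebraic equation 2X^2·V^3 − 3X·V^2 + V − 2 = 0. -/

import Mathlib

open PowerSeries Finset

theorem coeff_mk_mul_mk {R : Type*} [Semiring R] (a b : ℕ → R) (n : ℕ) :
    coeff n (PowerSeries.mk a * PowerSeries.mk b) = ∑ p ∈ range (n + 1), a (n - p) * b p := by
  rw [coeff_mul, Nat.sum_antidiagonal_eq_sum_range_succ_mk,
    ← sum_range_reflect]
  refine sum_congr rfl fun p hp => ?_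
  have hp' : p ≤ n := Nat.lt_succ_iff.mp (mem_range.mp hp)
  simp [Nat.sub_sub_self hp']

/-- The spherical generating functions `U`, `V` of the cubic matrix model satisfy
`V = 2U + X·V²` and `2X²·V³ - 3X·V² + V - 2 = 0` in `ℤ⟦X⟧`. -/
theorem cubic_spherical_V_equation (u v : ℕ → ℤ)
    (hu0 : u 0 = 1)
    (hu : ∀ k : ℕ, u (k + 1) = 2 * ∑ p ∈ Finset.range (k + 1), u (k - p) * v p)
    (hv : ∀ k : ℕ, v k = 2 * u k + ∑ p ∈ Finset.range k, v (k - 1 - p) * v p) :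
    PowerSeries.mk v = 2 * PowerSeries.mk u + PowerSeries.X * (PowerSeries.mk v) ^ 2 ∧
    2 * PowerSeries.X ^ 2 * (PowerSeries.mk v) ^ 3
      - 3 * PowerSeries.X * (PowerSeries.mk v) ^ 2 + PowerSeries.mk v - 2 = 0 := by
  have hV : PowerSeries.mk v =
      2 * PowerSeries.mk u + PowerSeries.X * (PowerSeries.mk v) ^ 2 := by
    ext (_ | k)
    · simpa [two_mul] using hv 0
    · rw [two_mul, map_add, map_add, coeff_succ_X_mul, sq, coeff_mk_mul_mk, coeff_mk, coeff_mk,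
        hv (k + 1), two_mul, Nat.add_sub_cancel]
  have hU : PowerSeries.mk u =
      1 + PowerSeries.X * (2 * (PowerSeries.mk u * PowerSeries.mk v)) := by
    ext (_ | k)
    · simp [hu0]
    · rw [map_add, coeff_succ_X_mul, two_mul, map_add, coeff_mk_mul_mk, coeff_mk, hu k, two_mul]
      simp [coeff_one]
  refine ⟨hV, ?_⟩
  linear_combination (1 - 2 * PowerSeries.X * PowerSeries.mk v) * hV + 2 * hU
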